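/- arXiv:2209.03627 — 2 statements merged into one kernel-verified Lean document; each statement's English description precedes it below -/
import Mathlib

section
/- Let ∇ be the affine connection on ℝ⁴ determined on coordinate vector fields by ∇_{∂₁}∂₁ = −∂₂, ∇_{∂₃}∂₃ = ∂₂, ∇_{∂₁}∂₂ = ∇_{∂₂}∂₁ = e^{−x₂}∂₁ + e^{x₁}∂₄, ∇_{∂₃}∂₄ = ∇_{∂₄}∂₃ = −e^{−x₂}∂₁ − e^{x₁}∂₄, ∇_{∂₁}∂₃ = ∇_{∂₃}∂₁ = ∂₄, ∇_{∂₁}∂₄ = ∇_{∂₄}∂₁ = ∇_{∂₂}∂₃ = ∇_{∂₃}∂₂ = e^{x₁}∂₂ − e^{−x₂}∂₃, ∇_{∂₂}∂₂ = −e^{x₁−x₂}∂₃, ∇_{∂₄}∂₄ = e^{x₁−x₂}∂₃, ∇_{∂₂}∂₄ = ∇_{∂₄}∂₂ = −e^{x₁−x₂}∂₁ − ∂₄, and let g be the x-dependent symmetric bilinear form on ℝ⁴ with matrix diag(−1, e^{−x₂}, −1, e^{−x₂}). Then the Codazzi equation holds: for all indices i, j, k ∈ {1,2,3,4} and every point of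 ℝ⁴, ∂_i g_{jk} − Σ_l Γ^l_{ij} g_{lk} − Σ_l Γ^l_{ik} g_{jl} = ∂_j g_{ik} − Σ_l Γ^l_{ji} g_{lk} − Σ_l Γ^l_{jk} g_{il}, where Γ^l_{ij} are the Christoffel symbols read off from the connection data above; hence (∇, g) is a statistical structure on ℝ⁴. -/
/-- The Christoffel symbols of the affine connection `∇` of Example 1 on `ℝ⁴`:
`Γ4 x i j l` is the `∂_l`-component of `∇_{∂_i} ∂_j` at the point `x`. -/
noncomputable def Γ4 (x : Fin 4 → ℝ) : Fin 4 → Fin 4 → Fin 4 → ℝ :=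
  ![![![0, -1, 0, 0],
      ![Real.exp (-(x 1)), 0, 0, Real.exp (x 0)],
      ![0, 0, 0, 1],
      ![0, Real.exp (x 0), -Real.exp (-(x 1)), 0]],
    ![![Real.exp (-(x 1)), 0, 0, Real.exp (x 0)],
      ![0, 0, -Real.exp (x 0 - x 1), 0],
      ![0, Real.exp (x 0), -Real.exp (-(x 1)), 0],
      ![-Real.exp (x 0 - x 1), 0, 0, -1]],
    ![![0, 0, 0, 1],
      ![0, Real.exp (x 0), -Real.exp (-(x 1)), 0],
      ![0, 1, 0, 0],
      ![-Real.exp (-(x 1)), 0, 0, -Real.exp (x 0)]],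
    ![![0, Real.exp (x 0), -Real.exp (-(x 1)), 0],
      ![-Real.exp (x 0 - x 1), 0, 0, -1],
      ![-Real.exp (-(x 1)), 0, 0, -Real.exp (x 0)],
      ![0, 0, Real.exp (x 0 - x 1), 0]]]

/-- The metric `g = diag(−1, e^{−x₂}, −1, e^{−x₂})` on `ℝ⁴`. -/
noncomputable def g4 (x : Fin 4 → ℝ) : Fin 4 → Fin 4 → ℝ :=
  ![![-1, 0, 0, 0],
    ![0, Real.exp (-(x 1)), 0, 0],
    ![0, 0, -1, 0],
    ![0, 0, 0, Real.exp (-(x 1))]]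

/-- The coefficient `e^{-x₂}` of the metric has only a `∂₂`-derivative. -/
lemma fderiv_exp_neg_coord_one (p v : Fin 4 → ℝ) :
    fderiv ℝ (fun x : Fin 4 → ℝ => Real.exp (-(x 1))) p v = -(Real.exp (-(p 1)) * v 1) := by
  have h : HasFDerivAt (fun x : Fin 4 → ℝ => Real.exp (-(x 1)))
      (Real.exp (-(p 1)) • -(ContinuousLinearMap.proj (R := ℝ) (φ := fun _ : Fin 4 => ℝ) 1)) p :=
    (hasFDerivAt_apply (𝕜 := ℝ) (F' := fun _ : Fin 4 => ℝ) 1 p).neg.exp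
  rw [h.fderiv]
  simp

/-- The Codazzi equation `(∇_{∂_i} g)(∂_j, ∂_k) = (∇_{∂_j} g)(∂_i, ∂_k)` holds at every
point of `ℝ⁴`; hence `(∇, g)` is a statistical structure on `ℝ⁴`. -/
theorem codazzi_equation_R4 :
    ∀ (i j k : Fin 4) (p : Fin 4 → ℝ),
      fderiv ℝ (fun x => g4 x j k) p (Pi.single i 1)
          - (∑ l, Γ4 p i j l * g4 p l k) - (∑ l, Γ4 p i k l * g4 p j l)
        = fderiv ℝ (fun x => g4 x i k) p (Pi.single j 1)
          - (∑ l, Γ4 p j i l * g4 p l k) - (∑ l, Γ4 p j k l * g4 p i l) := by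
  intro i j k p
  have h : Real.exp (p 0 - p 1) = Real.exp (p 0) * Real.exp (-(p 1)) := by
    rw [← Real.exp_add, sub_eq_add_neg]
  fin_cases i <;> fin_cases j <;> fin_cases k <;>
    simp [g4, Γ4, Fin.sum_univ_four, fderiv_exp_neg_coord_one, h]
end

section
/- Let V and H be finite-dimensional real inner product spaces with dim V = s ≥ 1, let t : V → H be a linear isometric embedding (⟨tU, tU'⟩ = ⟨U, U'⟩ for all U, U' ∈ V), and let N ∈ H lie in the range of t. If ⟨U, U'⟩·N = ⟨N, tU'⟩·tU for all U, U' ∈ V, then (s − 1)·N = 0; in particular, either s = 1 or N = 0. (This is the algebraic core of Proposition 4.8: an anti-invariant holomorphic statistical submersion with conformal fiber and ℋ∇_U P = 0 has either one-dimensional fibers or isometric (totally geodesic) fibers, N being the mean curvature vector.) -/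
open RealInnerProductSpace

/-- The algebraic core of Proposition 4.8: if `t : V → H` is a linear isometric embedding
of an `s`-dimensional space (`s ≥ 1`), `N` lies in the range of `t`, and
`⟨U,U'⟩·N = ⟨N,tU'⟩·tU` for all `U, U'`, then `(s − 1)·N = 0`; in particular either
`s = 1` (one-dimensional fibers) or `N = 0` (isometric fibers). -/
theorem dim_one_or_isometric_fiber
    {V H : Type*} [NormedAddCommGroup V] [InnerProductSpace ℝ V] [FiniteDimensional ℝ V]
    [NormedAddCommGroup H] [InnerProductSpace ℝ H] [FiniteDimensional ℝ H]
    (hs : 1 ≤ Module.finrank ℝ V)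
    (t : V →ₗ[ℝ] H) (ht : ∀ U U' : V, ⟪t U, t U'⟫ = ⟪U, U'⟫)
    (N : H) (hN : N ∈ LinearMap.range t)
    (hyp : ∀ U U' : V, ⟪U, U'⟫ • N = ⟪N, t U'⟫ • t U) :
    ((Module.finrank ℝ V : ℝ) - 1) • N = 0 ∧ (Module.finrank ℝ V = 1 ∨ N = 0) := by
  obtain ⟨W, rfl⟩ := hN
  let b := stdOrthonormalBasis ℝ V
  have hsum : (Module.finrank ℝ V : ℝ) • t W = t W := by
    calc (Module.finrank ℝ V : ℝ) • t W = ∑ i, ⟪b i, b i⟫ • t W := by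
          simp [Nat.cast_smul_eq_nsmul]
      _ = ∑ i, ⟪b i, W⟫ • t (b i) := by
          refine Finset.sum_congr rfl fun i _ => ?_
          rw [hyp, ht, real_inner_comm]
      _ = t W := by
          simpa only [map_sum, map_smul] using congrArg t (b.sum_repr' W)
  have hzero : ((Module.finrank ℝ V : ℝ) - 1) • t W = 0 := by
    rw [sub_smul, one_smul, hsum, sub_self]
  refine ⟨hzero, (smul_eq_zero.mp hzero).imp_left fun h => ?_⟩
  exact_mod_cast sub_eq_zero.mp h
end
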